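/- Let N ≥ 2, T > 0, ξ : [0,T] → ℝ^N continuous, and F(x,t) = ∫₀^t Φ(x-ξ(s), t-s) ds with Φ the heat kernel. Then F satisfies the heat equation with a moving Dirac source in the distribution sense: for every test function φ ∈ C_c^∞(ℝ^N × (0,T)), ∫₀^T ∫_{ℝ^N} (-φ_t - Δφ) F dx dt = ∫₀^T φ(ξ(t), t) dt. -/

import Mathlib

open MeasureTheory Real Set Metric

noncomputable section

/-- The heat kernel on ℝ^N. -/
def heatKernel (N : ℕ) (x : EuclideanSpace ℝ (Fin N)) (t : ℝ) : ℝ :=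
  (4 * π * t) ^ (-(N : ℝ) / 2) * Real.exp (-‖x‖ ^ 2 / (4 * t))

/-- The time-integrated heat kernel along the curve ξ. -/
def Fsol (N : ℕ) (ξ : ℝ → EuclideanSpace ℝ (Fin N))
    (x : EuclideanSpace ℝ (Fin N)) (t : ℝ) : ℝ :=
  ∫ s in (0 : ℝ)..t, heatKernel N (x - ξ s) (t - s)

section

variable {N : ℕ}

lemma heatKernel_nonneg (x : EuclideanSpace ℝ (Fin N)) {r : ℝ} (hr : 0 ≤ r) :
    0 ≤ heatKernel N x r := by
  unfold heatKernel
  positivity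

lemma integral_heatKernel {r : ℝ} (hr : 0 < r) : ∫ x, heatKernel N x r = 1 := by
  have h := GaussianFourier.integral_rexp_neg_mul_sq_norm (V := EuclideanSpace ℝ (Fin N))
    (show 0 < 1 / (4 * r) by positivity)
  have hb : π / (1 / (4 * r)) = 4 * π * r := by field_simp
  have hpos : (0 : ℝ) < 4 * π * r := by positivity
  rw [finrank_euclideanSpace_fin, hb] at h
  unfold heatKernel
  rw [integral_const_mul]
  have : (fun x : EuclideanSpace ℝ (Fin N) => rexp (-‖x‖ ^ 2 / (4 * r)))
      = fun x => rexp (-(1 / (4 * r)) * ‖x‖ ^ 2) := by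
    ext x; congr 1; ring
  rw [this, h, ← Real.rpow_add hpos]
  simp [neg_div]

lemma integrable_heatKernel {r : ℝ} (hr : 0 < r) : Integrable (fun x => heatKernel N x r) :=
  .of_integral_ne_zero (by rw [integral_heatKernel hr]; exact one_ne_zero)

lemma continuous_heatKernel (r : ℝ) : Continuous (fun x => heatKernel N x r) := by
  unfold heatKernel
  fun_prop

lemma measurable_heatKernel :
    Measurable (fun p : EuclideanSpace ℝ (Fin N) × ℝ => heatKernel N p.1 p.2) := by
  unfold heatKernel
  fun_prop

lemma heatKernel_sqrt_smul (z : EuclideanSpace ℝ (Fin N)) {r : ℝ} (hr : 0 < r) :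
    heatKernel N (√r • z) r = (√r ^ N)⁻¹ * heatKernel N z 1 := by
  have h1 : (4 * π * r) ^ (-(N : ℝ) / 2) = (4 * π * 1) ^ (-(N : ℝ) / 2) * (√r ^ N)⁻¹ := by
    rw [mul_one, Real.mul_rpow (by positivity) hr.le, neg_div, Real.rpow_neg hr.le,
      Real.sqrt_eq_rpow, ← Real.rpow_natCast, ← Real.rpow_mul hr.le]
    congr 3
    ring
  have h2 : -‖√r • z‖ ^ 2 / (4 * r) = -‖z‖ ^ 2 / (4 * 1) := by
    rw [norm_smul, mul_pow, Real.norm_eq_abs, sq_abs, Real.sq_sqrt hr.le]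
    field_simp
  unfold heatKernel
  rw [h1, h2]
  ring

/-- Parabolic rescaling of integrals against the heat kernel. -/
lemma integral_mul_heatKernel (f : EuclideanSpace ℝ (Fin N) → ℝ)
    (y : EuclideanSpace ℝ (Fin N)) {r : ℝ} (hr : 0 < r) :
    ∫ x, f x * heatKernel N (x - y) r = ∫ z, f (y + √r • z) * heatKernel N z 1 := by
  have hs : 0 < √r := Real.sqrt_pos.2 hr
  rw [← integral_add_left_eq_self _ y]
  have h := Measure.integral_comp_smul (volume : Measure (EuclideanSpace ℝ (Fin N)))
    (fun x => f (y + x) * heatKernel N (y + x - y) r) √r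
  have hpos : 0 < (√r ^ N)⁻¹ := by positivity
  rw [finrank_euclideanSpace_fin, abs_of_pos hpos] at h
  simp only [add_sub_cancel_left, heatKernel_sqrt_smul _ hr, smul_eq_mul] at h ⊢
  simp only [mul_left_comm _ (√r ^ N)⁻¹, integral_const_mul] at h
  exact (mul_left_cancel₀ hpos.ne' h).symm

lemma integrable_norm_mul_heatKernel :
    Integrable (fun z : EuclideanSpace ℝ (Fin N) => ‖z‖ * heatKernel N z 1) := by
  set c : ℝ := (4 * π * 1) ^ (-(N : ℝ) / 2)
  set d : ℝ := (4 * π * 2) ^ (-(N : ℝ) / 2) with hd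
  have hdpos : 0 < d := by positivity
  refine ((integrable_heatKernel (N := N) two_pos).const_mul (2 * c / d)).mono'
    (continuous_norm.mul (continuous_heatKernel 1)).aestronglyMeasurable (.of_forall fun z => ?_)
  rw [Real.norm_of_nonneg (mul_nonneg (norm_nonneg z) (heatKernel_nonneg z one_pos.le))]
  have h1 : ‖z‖ ≤ 2 * rexp (‖z‖ ^ 2 / 8) := by
    nlinarith [Real.add_one_le_exp (‖z‖ ^ 2 / 8), sq_nonneg (‖z‖ - 4)]
  have h2 : rexp (‖z‖ ^ 2 / 8) * rexp (-‖z‖ ^ 2 / (4 * 1)) = rexp (-‖z‖ ^ 2 / (4 * 2)) := by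
    rw [← Real.exp_add]; congr 1; ring
  calc ‖z‖ * heatKernel N z 1
      ≤ 2 * rexp (‖z‖ ^ 2 / 8) * (c * rexp (-‖z‖ ^ 2 / (4 * 1))) :=
        mul_le_mul_of_nonneg_right h1 (heatKernel_nonneg z one_pos.le)
    _ = 2 * c * rexp (-‖z‖ ^ 2 / (4 * 2)) := by rw [← h2]; ring
    _ = 2 * c / d * heatKernel N z 2 := by
        unfold heatKernel
        rw [← hd]
        field_simp

lemma hasFDerivAt_heatKernel_one (z : EuclideanSpace ℝ (Fin N)) :
    HasFDerivAt (fun x => heatKernel N x 1) (-(heatKernel N z 1 / 2) • innerSL ℝ z) z := by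
  have h := ((((hasStrictFDerivAt_norm_sq z).hasFDerivAt.neg.mul_const
    (4 * 1 : ℝ)⁻¹).exp).const_mul ((4 * π * 1) ^ (-(N : ℝ) / 2)))
  refine h.congr_fderiv ?_
  ext v
  simp [heatKernel, div_eq_mul_inv]
  ring

lemma integrable_bdd_mul_heatKernel {f : EuclideanSpace ℝ (Fin N) → ℝ} {C : ℝ}
    (hf : Continuous f) (hC : ∀ z, ‖f z‖ ≤ C) :
    Integrable (fun z => f z * heatKernel N z 1) :=
  (integrable_heatKernel one_pos).bdd_mul hf.aestronglyMeasurable (.of_forall hC)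

/-- Gaussian integration by parts. -/
lemma integral_coord_mul_heatKernel {f : EuclideanSpace ℝ (Fin N) → ℝ} {C C' : ℝ} (i : Fin N)
    (hf : ContDiff ℝ 1 f) (hC : ∀ z, ‖f z‖ ≤ C)
    (hC' : ∀ z, ‖fderiv ℝ f z (EuclideanSpace.single i 1)‖ ≤ C') :
    ∫ z, z i * f z * heatKernel N z 1
      = 2 * ∫ z, fderiv ℝ f z (EuclideanSpace.single i 1) * heatKernel N z 1 := by
  have hK : ∀ z, fderiv ℝ (fun x => heatKernel N x 1) z (EuclideanSpace.single i 1)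
      = -(1 / 2) * (z i * heatKernel N z 1) := fun z => by
    rw [(hasFDerivAt_heatKernel_one z).fderiv]
    simp [EuclideanSpace.inner_single_right]
    ring
  have hz : Integrable (fun z : EuclideanSpace ℝ (Fin N) => z i * heatKernel N z 1) := by
    refine integrable_norm_mul_heatKernel.mono' ?_ (.of_forall fun z => ?_)
    · exact ((by fun_prop : Continuous fun z : EuclideanSpace ℝ (Fin N) => z i).mul
        (continuous_heatKernel 1)).aestronglyMeasurable
    · rw [norm_mul, Real.norm_of_nonneg (heatKernel_nonneg z one_pos.le)]
      exact mul_le_mul_of_nonneg_right (PiLp.norm_apply_le z i) (heatKernel_nonneg z one_pos.le)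
  have h := integral_mul_fderiv_eq_neg_fderiv_mul_of_integrable (μ := volume)
    (f := f) (g := fun x => heatKernel N x 1) (v := EuclideanSpace.single i (1 : ℝ))
    (integrable_bdd_mul_heatKernel
      ((hf.continuous_fderiv one_ne_zero).clm_apply continuous_const) hC')
    (by
      simp only [hK]
      exact (hz.const_mul _).bdd_mul hf.continuous.aestronglyMeasurable (.of_forall hC))
    (integrable_bdd_mul_heatKernel hf.continuous hC)
    (fun z _ => hf.differentiable one_ne_zero z)
    (fun z _ => (hasFDerivAt_heatKernel_one z).differentiableAt)
  simp only [hK] at h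
  have h' : ∀ z : EuclideanSpace ℝ (Fin N), f z * (-(1 / 2) * (z i * heatKernel N z 1))
      = -(1 / 2) * (z i * f z * heatKernel N z 1) := fun z => by ring
  simp only [h', integral_const_mul] at h
  linarith

/-- The backward heat operator `∂ₜ + Δ` applied to a function on space-time. -/
def backwardHeat (φ : EuclideanSpace ℝ (Fin N) × ℝ → ℝ) (p : EuclideanSpace ℝ (Fin N) × ℝ) : ℝ :=
  fderiv ℝ φ p (0, 1) + ∑ i, fderiv ℝ
    (fun q => fderiv ℝ φ q (EuclideanSpace.single i 1, 0)) p (EuclideanSpace.single i 1, 0)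

lemma contDiff_fderiv_const {E : Type*} [NormedAddCommGroup E] [NormedSpace ℝ E] {φ : E → ℝ}
    (hφ : ContDiff ℝ (⊤ : ℕ∞) φ) (v : E) : ContDiff ℝ (⊤ : ℕ∞) (fun q => fderiv ℝ φ q v) :=
  (hφ.fderiv_right (m := (⊤ : ℕ∞)) le_rfl).clm_apply contDiff_const

lemma continuous_backwardHeat {φ : EuclideanSpace ℝ (Fin N) × ℝ → ℝ}
    (hφ : ContDiff ℝ (⊤ : ℕ∞) φ) : Continuous (backwardHeat φ) :=
  (contDiff_fderiv_const hφ _).continuous.add <| continuous_finsetSum _ fun _ _ =>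
    (contDiff_fderiv_const (contDiff_fderiv_const hφ _) _).continuous

lemma exists_bound_backwardHeat {φ : EuclideanSpace ℝ (Fin N) × ℝ → ℝ}
    (hφ : ContDiff ℝ (⊤ : ℕ∞) φ) (hφc : HasCompactSupport φ) :
    ∃ C, ∀ p, ‖backwardHeat φ p‖ ≤ C := by
  obtain ⟨C₀, hC₀⟩ := (hφc.fderiv_apply (𝕜 := ℝ) (0, 1)).exists_bound_of_continuous
    (contDiff_fderiv_const hφ _).continuous
  have h (i : Fin N) := ((hφc.fderiv_apply (𝕜 := ℝ) (EuclideanSpace.single i 1, 0)).fderiv_apply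
    (𝕜 := ℝ) (EuclideanSpace.single i 1, 0)).exists_bound_of_continuous
    (contDiff_fderiv_const (contDiff_fderiv_const hφ _) _).continuous
  choose C hC using h
  exact ⟨C₀ + ∑ i, C i, fun p => (norm_add_le _ _).trans <|
    add_le_add (hC₀ p) <| norm_sum_le_of_le _ fun i _ => hC i p⟩

lemma backwardHeat_eq {φ : EuclideanSpace ℝ (Fin N) × ℝ → ℝ} (hφ : ContDiff ℝ (⊤ : ℕ∞) φ)
    (p : EuclideanSpace ℝ (Fin N) × ℝ) :
    backwardHeat φ p = deriv (fun τ => φ (p.1, τ)) p.2 + ∑ i, iteratedDeriv 2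
      (fun h : ℝ => φ (p.1 + h • EuclideanSpace.single i (1 : ℝ), p.2)) 0 := by
  have line {f : EuclideanSpace ℝ (Fin N) × ℝ → ℝ} (hf : ContDiff ℝ (⊤ : ℕ∞) f)
      (v : EuclideanSpace ℝ (Fin N)) :
      deriv (fun h : ℝ => f (p.1 + h • v, p.2))
        = fun h => fderiv ℝ f (p.1 + h • v, p.2) (v, 0) := by
    ext h
    have h1 : HasDerivAt (fun h : ℝ => (p.1 + h • v, p.2)) (v, 0) h := by
      simpa using (((hasDerivAt_id h).smul_const v).const_add p.1).prodMk (hasDerivAt_const h p.2)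
    exact ((hf.differentiable (by simp) _).hasFDerivAt.comp_hasDerivAt h h1).deriv
  have time : deriv (fun τ => φ (p.1, τ)) p.2 = fderiv ℝ φ p (0, 1) :=
    ((hφ.differentiable (by simp) p).hasFDerivAt.comp_hasDerivAt p.2
      ((hasDerivAt_const p.2 p.1).prodMk (hasDerivAt_id p.2))).deriv
  rw [backwardHeat, time]
  congr 1
  refine Finset.sum_congr rfl fun i _ => ?_
  rw [iteratedDeriv_succ, iteratedDeriv_one, line hφ, line (contDiff_fderiv_const hφ _)]
  simp

lemma fderiv_rescaled {f : EuclideanSpace ℝ (Fin N) × ℝ → ℝ} (hf : ContDiff ℝ (⊤ : ℕ∞) f)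
    (y v z : EuclideanSpace ℝ (Fin N)) (a t : ℝ) :
    fderiv ℝ (fun z => f (y + a • z, t)) z v = a * fderiv ℝ f (y + a • z, t) (v, 0) := by
  have h1 : HasFDerivAt (fun z : EuclideanSpace ℝ (Fin N) => (y + a • z, t))
      ((a • ContinuousLinearMap.id ℝ _).prod 0) z :=
    (((hasFDerivAt_id z).const_smul a).const_add y).prodMk (hasFDerivAt_const t z)
  have h := ((hf.differentiable (by simp) (y + a • z, t)).hasFDerivAt.comp z h1).fderiv
  simp only [Function.comp_def] at h
  rw [h]
  have : ((a • v, (0 : ℝ)) : EuclideanSpace ℝ (Fin N) × ℝ) = a • (v, 0) := by simp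
  simpa using this ▸ map_smul (fderiv ℝ f (y + a • z, t)) a ((v, 0) : _ × ℝ)

lemma fderiv_prod_apply_eq {f : EuclideanSpace ℝ (Fin N) × ℝ → ℝ}
    (p : EuclideanSpace ℝ (Fin N) × ℝ) (c : ℝ) (z : EuclideanSpace ℝ (Fin N)) :
    fderiv ℝ f p (c • z, 1)
      = fderiv ℝ f p (0, 1) + c * ∑ i, z i * fderiv ℝ f p (EuclideanSpace.single i 1, 0) := by
  have hz : z = ∑ i, z i • EuclideanSpace.single i (1 : ℝ) := by
    conv_lhs => rw [← (EuclideanSpace.basisFun (Fin N) ℝ).sum_repr z]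
    simp
  have h1 : ((c • z, 1) : EuclideanSpace ℝ (Fin N) × ℝ)
      = (0, 1) + c • ContinuousLinearMap.inl ℝ (EuclideanSpace ℝ (Fin N)) ℝ z := by simp
  have h2 : fderiv ℝ f p (ContinuousLinearMap.inl ℝ (EuclideanSpace ℝ (Fin N)) ℝ z)
      = ∑ i, z i * fderiv ℝ f p (EuclideanSpace.single i 1, 0) := by
    conv_lhs => rw [hz]
    simp only [map_sum, map_smul, smul_eq_mul, ContinuousLinearMap.inl_apply]
  rw [h1, map_add, map_smul, h2, smul_eq_mul]

lemma hasDerivAt_gaussianMean {φ : EuclideanSpace ℝ (Fin N) × ℝ → ℝ}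
    (hφ : ContDiff ℝ (⊤ : ℕ∞) φ) (hφc : HasCompactSupport φ)
    (y : EuclideanSpace ℝ (Fin N)) (s : ℝ) {r : ℝ} (hr : 0 < r) :
    HasDerivAt (fun r => ∫ z, φ (y + √r • z, s + r) * heatKernel N z 1)
      (∫ z, backwardHeat φ (y + √r • z, s + r) * heatKernel N z 1) r := by
  have hdiff := hφ.differentiable (by simp)
  have hcont := hφ.continuous
  have hdcont : Continuous (fderiv ℝ φ) := hφ.continuous_fderiv (by simp)
  obtain ⟨C, hC⟩ := hφc.exists_bound_of_continuous hcont
  obtain ⟨M, hM⟩ := (hφc.fderiv ℝ).exists_bound_of_continuous hdcont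
  have hM0 : 0 ≤ M := (norm_nonneg _).trans (hM 0)
  have hKc := continuous_heatKernel (N := N) 1
  have key := (hasDerivAt_integral_of_dominated_loc_of_deriv_le (μ := volume)
    (F := fun r z => φ (y + √r • z, s + r) * heatKernel N z 1)
    (F' := fun r z => fderiv ℝ φ (y + √r • z, s + r) ((1 / (2 * √r)) • z, 1) * heatKernel N z 1)
    (bound := fun z => M * (1 / (2 * √(r / 2))) * (‖z‖ * heatKernel N z 1)
      + M * heatKernel N z 1) (s := Ioi (r / 2)) (x₀ := r)
    (Ioi_mem_nhds (by linarith))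
    (.of_forall fun r => ((by fun_prop : Continuous fun z : EuclideanSpace ℝ (Fin N) =>
      φ (y + √r • z, s + r)).mul hKc).aestronglyMeasurable)
    (integrable_bdd_mul_heatKernel (by fun_prop) fun z => hC _)
    (((hdcont.comp (by fun_prop)).clm_apply (by fun_prop)).mul hKc).aestronglyMeasurable
    (.of_forall fun z ρ hρ => ?_)
    ((integrable_norm_mul_heatKernel.const_mul _).add
      ((integrable_heatKernel one_pos).const_mul _))
    (.of_forall fun z ρ hρ => ?_)).2
  · refine key.congr_deriv ?_
    have hs : 0 < √r := Real.sqrt_pos.2 hr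
    set D : Fin N → EuclideanSpace ℝ (Fin N) × ℝ → ℝ :=
      fun i q => fderiv ℝ φ q (EuclideanSpace.single i 1, 0) with hD
    have hDs (i) : ContDiff ℝ (⊤ : ℕ∞) (D i) := contDiff_fderiv_const hφ _
    have hDc (i) : HasCompactSupport (D i) := hφc.fderiv_apply (𝕜 := ℝ) _
    have hDDs (i) := contDiff_fderiv_const (hDs i) (EuclideanSpace.single i 1, 0)
    choose C₁ hC₁ using fun i => (hDc i).exists_bound_of_continuous (hDs i).continuous
    choose C₂ hC₂ using fun i => ((hDc i).fderiv_apply (𝕜 := ℝ)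
      (EuclideanSpace.single i 1, 0)).exists_bound_of_continuous (hDDs i).continuous
    obtain ⟨C₀, hC₀⟩ := (hφc.fderiv_apply (𝕜 := ℝ) (0, 1)).exists_bound_of_continuous
      (contDiff_fderiv_const hφ _).continuous
    have i0 : Integrable fun z => fderiv ℝ φ (y + √r • z, s + r) (0, 1) * heatKernel N z 1 :=
      integrable_bdd_mul_heatKernel
        ((contDiff_fderiv_const hφ _).continuous.comp (by fun_prop)) fun z => hC₀ _
    have i1 (i) : Integrable fun z => z i * D i (y + √r • z, s + r) * heatKernel N z 1 := by
      refine (integrable_norm_mul_heatKernel.const_mul (C₁ i)).mono' ?_ (.of_forall fun z => ?_)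
      · exact (((by fun_prop : Continuous fun z : EuclideanSpace ℝ (Fin N) => z i).mul
          ((hDs i).continuous.comp (by fun_prop))).mul hKc).aestronglyMeasurable
      · rw [norm_mul, norm_mul, Real.norm_of_nonneg (heatKernel_nonneg z one_pos.le),
          mul_comm ‖z i‖, mul_assoc]
        have := heatKernel_nonneg z one_pos.le
        have h1 := (norm_nonneg _).trans (hC₁ i 0)
        gcongr
        · exact hC₁ i _
        · exact PiLp.norm_apply_le z i
    have i2 (i) : Integrable fun z => fderiv ℝ (D i) (y + √r • z, s + r)
        (EuclideanSpace.single i 1, 0) * heatKernel N z 1 :=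
      integrable_bdd_mul_heatKernel ((hDDs i).continuous.comp (by fun_prop)) fun z => hC₂ i _
    have ibp (i) : ∫ z, z i * D i (y + √r • z, s + r) * heatKernel N z 1
        = 2 * √r * ∫ z, fderiv ℝ (D i) (y + √r • z, s + r)
          (EuclideanSpace.single i 1, 0) * heatKernel N z 1 := by
      rw [integral_coord_mul_heatKernel (C := C₁ i) (C' := √r * C₂ i) i
        (f := fun z => D i (y + √r • z, s + r))]
      · simp only [fderiv_rescaled (hDs i), mul_assoc, integral_const_mul]
      · exact ((hDs i).of_le (by simp)).comp (by fun_prop)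
      · exact fun z => hC₁ i _
      · intro z
        rw [fderiv_rescaled (hDs i), norm_mul, Real.norm_of_nonneg hs.le]
        exact mul_le_mul_of_nonneg_left (hC₂ i _) hs.le
    simp only [fderiv_prod_apply_eq, backwardHeat, add_mul, mul_assoc, Finset.sum_mul]
    simp only [← mul_assoc]
    rw [integral_add i0, integral_add i0, integral_finsetSum _ fun i _ => i2 i]
    · congr 1
      rw [integral_const_mul, integral_finsetSum _ fun i _ => i1 i, Finset.mul_sum]
      refine Finset.sum_congr rfl fun i _ => ?_
      rw [ibp]
      field_simp
    · exact integrable_finsetSum _ fun i _ => i2 i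
    · exact (integrable_finsetSum _ fun i _ => i1 i).const_mul _
  · have hρ' : r / 2 < ρ := hρ
    have hK := heatKernel_nonneg z one_pos.le
    have h0 : 0 < √(r / 2) := Real.sqrt_pos.2 (by linarith)
    have h1 : √(r / 2) ≤ √ρ := Real.sqrt_le_sqrt hρ'.le
    have h2 : ‖(((1 / (2 * √ρ)) • z, 1) : EuclideanSpace ℝ (Fin N) × ℝ)‖
        ≤ 1 / (2 * √(r / 2)) * ‖z‖ + 1 := by
      rw [Prod.norm_def, norm_smul, Real.norm_of_nonneg (by positivity), norm_one]
      have : 1 / (2 * √ρ) * ‖z‖ ≤ 1 / (2 * √(r / 2)) * ‖z‖ := by gcongr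
      have h3 : 0 ≤ 1 / (2 * √(r / 2)) * ‖z‖ := by positivity
      exact max_le (by linarith) (by linarith)
    rw [norm_mul, Real.norm_of_nonneg hK]
    calc _ ≤ M * (1 / (2 * √(r / 2)) * ‖z‖ + 1) * heatKernel N z 1 := by
          gcongr
          exact ((fderiv ℝ φ _).le_opNorm _).trans (mul_le_mul (hM _) h2 (norm_nonneg _) hM0)
      _ = _ := by ring
  · have hρ0 : 0 < ρ := lt_trans (by linarith) (show r / 2 < ρ from hρ)
    have h1 : HasDerivAt (fun r => (y + √r • z, s + r)) ((1 / (2 * √ρ)) • z, 1) ρ :=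
      (((Real.hasDerivAt_sqrt hρ0.ne').smul_const z).const_add y).prodMk
        ((hasDerivAt_id ρ).const_add s)
    exact ((hdiff _).hasFDerivAt.comp_hasDerivAt ρ h1).mul_const _

lemma continuous_gaussianMean {f : EuclideanSpace ℝ (Fin N) × ℝ → ℝ} (hf : Continuous f) {C : ℝ}
    (hC : ∀ p, ‖f p‖ ≤ C) (y : EuclideanSpace ℝ (Fin N)) (s : ℝ) :
    Continuous (fun r => ∫ z, f (y + √r • z, s + r) * heatKernel N z 1) := by
  refine continuous_of_dominated (bound := fun z => C * heatKernel N z 1) (fun r => ?_)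
    (fun r => .of_forall fun z => ?_) ((integrable_heatKernel one_pos).const_mul _)
    (.of_forall fun z => by fun_prop)
  · exact ((by fun_prop : Continuous fun z : EuclideanSpace ℝ (Fin N) =>
      f (y + √r • z, s + r)).mul (continuous_heatKernel 1)).aestronglyMeasurable
  · rw [norm_mul, Real.norm_of_nonneg (heatKernel_nonneg z one_pos.le)]
    exact mul_le_mul_of_nonneg_right (hC _) (heatKernel_nonneg z one_pos.le)

/-- The heat kernel is a fundamental solution, tested against a function vanishing at time `T`. -/
lemma integral_backwardHeat_mul_heatKernel {φ : EuclideanSpace ℝ (Fin N) × ℝ → ℝ}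
    (hφ : ContDiff ℝ (⊤ : ℕ∞) φ) (hφc : HasCompactSupport φ) {s T : ℝ} (hs : s ≤ T)
    (hT : ∀ x, φ (x, T) = 0) (y : EuclideanSpace ℝ (Fin N)) :
    ∫ t in s..T, ∫ x, -backwardHeat φ (x, t) * heatKernel N (x - y) (t - s) = φ (y, s) := by
  obtain ⟨C, hC⟩ := hφc.exists_bound_of_continuous hφ.continuous
  obtain ⟨M, hM⟩ := exists_bound_backwardHeat hφ hφc
  have h := intervalIntegral.integral_eq_sub_of_hasDerivAt_of_le (sub_nonneg.2 hs)
    (continuous_gaussianMean hφ.continuous hC y s).continuousOn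
    (fun r hr => hasDerivAt_gaussianMean hφ hφc y s hr.1)
    ((continuous_gaussianMean (continuous_backwardHeat hφ) hM y s).intervalIntegrable _ _)
  simp only [add_sub_cancel, hT, zero_mul, integral_zero, Real.sqrt_zero, zero_smul, add_zero,
    integral_const_mul, integral_heatKernel one_pos, mul_one, zero_sub] at h
  calc _ = ∫ t in s..T, -∫ z, backwardHeat φ (y + √(t - s) • z, s + (t - s))
          * heatKernel N z 1 := by
        refine intervalIntegral.integral_congr_ae (.of_forall fun t ht => ?_)
        rw [uIoc_of_le hs] at ht
        rw [integral_mul_heatKernel _ y (sub_pos.2 ht.1), ← integral_neg]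
        simp
    _ = φ (y, s) := by
        rw [intervalIntegral.integral_neg, intervalIntegral.integral_comp_sub_right
          (fun r => ∫ z, backwardHeat φ (y + √r • z, s + r) * heatKernel N z 1) s, sub_self, h,
          neg_neg]

/-- The space-time integrand of the Duhamel formula, extended by zero outside `0 < s < t < T`. -/
def duhamelIntegrand (g : EuclideanSpace ℝ (Fin N) × ℝ → ℝ) (ξ : ℝ → EuclideanSpace ℝ (Fin N))
    (T : ℝ) : (EuclideanSpace ℝ (Fin N) × ℝ) × ℝ → ℝ :=
  indicator {q | 0 < q.2 ∧ q.2 < q.1.2 ∧ q.1.2 < T}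
    fun q => g q.1 * heatKernel N (q.1.1 - ξ q.2) (q.1.2 - q.2)

lemma lintegral_enorm_mul_heatKernel_le {g : EuclideanSpace ℝ (Fin N) → ℝ} {M : ℝ}
    (hM : ∀ x, ‖g x‖ ≤ M) (y : EuclideanSpace ℝ (Fin N)) {r : ℝ} (hr : 0 < r) :
    ∫⁻ x, ‖g x * heatKernel N (x - y) r‖ₑ ≤ ENNReal.ofReal M := by
  have hM0 : 0 ≤ M := (norm_nonneg _).trans (hM 0)
  calc ∫⁻ x, ‖g x * heatKernel N (x - y) r‖ₑ
      ≤ ∫⁻ x, ENNReal.ofReal M * ENNReal.ofReal (heatKernel N (x - y) r) := by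
        refine lintegral_mono fun x => ?_
        have hK := heatKernel_nonneg (x - y) hr.le
        rw [← ENNReal.ofReal_mul hM0, ← ofReal_norm, norm_mul, Real.norm_of_nonneg hK]
        exact ENNReal.ofReal_le_ofReal (mul_le_mul_of_nonneg_right (hM x) hK)
    _ = ENNReal.ofReal M := by
        rw [lintegral_const_mul' _ _ ENNReal.ofReal_ne_top,
          lintegral_sub_right_eq_self (fun x => ENNReal.ofReal (heatKernel N x r)),
          ← ofReal_integral_eq_lintegral_ofReal (integrable_heatKernel hr)
            (.of_forall fun x => heatKernel_nonneg x hr.le), integral_heatKernel hr]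
        simp

lemma integrable_duhamelIntegrand {g : EuclideanSpace ℝ (Fin N) × ℝ → ℝ} (hg : Measurable g)
    {M : ℝ} (hM : ∀ p, ‖g p‖ ≤ M) {ξ : ℝ → EuclideanSpace ℝ (Fin N)} (hξ : Measurable ξ) (T : ℝ) :
    Integrable (duhamelIntegrand g ξ T) := by
  have hmeas : Measurable (duhamelIntegrand g ξ T) := by
    refine Measurable.indicator ?_ ?_
    · exact (hg.comp measurable_fst).mul (measurable_heatKernel.comp
        ((measurable_fst.fst.sub (hξ.comp measurable_snd)).prodMk
          (measurable_fst.snd.sub measurable_snd)))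
    · exact (measurableSet_lt measurable_const measurable_snd).inter
        ((measurableSet_lt measurable_snd measurable_fst.snd).inter
          (measurableSet_lt measurable_fst.snd measurable_const))
  refine ⟨hmeas.aestronglyMeasurable, ?_⟩
  have hslice (s t : ℝ) : ∫⁻ x, ‖duhamelIntegrand g ξ T ((x, t), s)‖ₑ
      ≤ (Ioo 0 T).indicator (fun _ => (Ioo 0 T).indicator (fun _ => ENNReal.ofReal M) t) s := by
    by_cases h : 0 < s ∧ s < t ∧ t < T
    · have hs : s ∈ Ioo 0 T := ⟨h.1, h.2.1.trans h.2.2⟩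
      have ht : t ∈ Ioo 0 T := ⟨h.1.trans h.2.1, h.2.2⟩
      simp only [duhamelIntegrand, indicator_of_mem hs, indicator_of_mem ht]
      refine le_trans (lintegral_mono fun x => ?_) (lintegral_enorm_mul_heatKernel_le
        (g := fun x => g (x, t)) (fun x => hM _) (ξ s) (sub_pos.2 h.2.1))
      rw [indicator_of_mem (by exact h)]
    · have (x : EuclideanSpace ℝ (Fin N)) : duhamelIntegrand g ξ T ((x, t), s) = 0 :=
        indicator_of_notMem (by exact h) _
      simp [this]
  rw [HasFiniteIntegral, Measure.volume_eq_prod, lintegral_prod_symm' _ hmeas.enorm]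
  calc _ ≤ ∫⁻ s : ℝ, ∫⁻ t : ℝ, (Ioo 0 T).indicator
          (fun _ => (Ioo 0 T).indicator (fun _ => ENNReal.ofReal M) t) s := by
        refine lintegral_mono fun s => ?_
        rw [Measure.volume_eq_prod, lintegral_prod_symm'
          (fun p => ‖duhamelIntegrand g ξ T (p, s)‖ₑ) (hmeas.comp measurable_prodMk_right).enorm]
        exact lintegral_mono fun t => hslice s t
    _ ≤ ∫⁻ s : ℝ, (Ioo 0 T).indicator
          (fun _ => ENNReal.ofReal M * volume (Ioo (0 : ℝ) T)) s := by
        refine lintegral_mono fun s => ?_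
        by_cases hs : s ∈ Ioo 0 T
        · simp only [indicator_of_mem hs]
          rw [lintegral_indicator measurableSet_Ioo, setLIntegral_const]
        · simp [indicator_of_notMem hs]
    _ < ⊤ := by
        rw [lintegral_indicator measurableSet_Ioo, setLIntegral_const, Real.volume_Ioo]
        finiteness

lemma setIntegral_mul_Fsol {g : EuclideanSpace ℝ (Fin N) × ℝ → ℝ}
    {ξ : ℝ → EuclideanSpace ℝ (Fin N)} {T : ℝ} :
    ∫ p in (univ : Set (EuclideanSpace ℝ (Fin N))) ×ˢ Ioo (0 : ℝ) T, g p * Fsol N ξ p.1 p.2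
      = ∫ p, ∫ s, duhamelIntegrand g ξ T (p, s) := by
  rw [← integral_indicator (MeasurableSet.univ.prod measurableSet_Ioo)]
  refine integral_congr_ae (.of_forall fun p => ?_)
  by_cases hp : p.2 ∈ Ioo 0 T
  · have h (s : ℝ) : duhamelIntegrand g ξ T (p, s) = (Ioo 0 p.2).indicator
        (fun s => g p * heatKernel N (p.1 - ξ s) (p.2 - s)) s := by
      simp only [duhamelIntegrand, indicator_apply]
      exact if_congr ⟨fun h => ⟨h.1, h.2.1⟩, fun h => ⟨h.1, h.2, hp.2⟩⟩ rfl rfl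
    simp only [h]
    rw [indicator_of_mem (by exact ⟨mem_univ _, hp⟩), integral_indicator measurableSet_Ioo,
      integral_const_mul, Fsol, intervalIntegral.integral_of_le hp.1.le,
      integral_Ioc_eq_integral_Ioo]
  · have h (s : ℝ) : duhamelIntegrand g ξ T (p, s) = 0 :=
      indicator_of_notMem (fun h => hp ⟨h.1.trans h.2.1, h.2.2⟩) _
    simp only [h, integral_zero]
    exact indicator_of_notMem (fun h => hp h.2) _

lemma integral_integral_duhamelIntegrand {g : EuclideanSpace ℝ (Fin N) × ℝ → ℝ}
    (hg : Measurable g) {M : ℝ} (hM : ∀ p, ‖g p‖ ≤ M) {ξ : ℝ → EuclideanSpace ℝ (Fin N)}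
    (hξ : Measurable ξ) {T : ℝ} (hT : 0 ≤ T) :
    ∫ p, ∫ s, duhamelIntegrand g ξ T (p, s)
      = ∫ s in (0 : ℝ)..T, ∫ t in s..T, ∫ x, g (x, t) * heatKernel N (x - ξ s) (t - s) := by
  have hG := integrable_duhamelIntegrand hg hM hξ T
  rw [Measure.volume_eq_prod] at hG
  rw [integral_integral_swap (f := fun p s => duhamelIntegrand g ξ T (p, s)) hG,
    intervalIntegral.integral_of_le hT, integral_Ioc_eq_integral_Ioo,
    ← integral_indicator measurableSet_Ioo]
  refine integral_congr_ae ?_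
  filter_upwards [hG.prod_left_ae] with s hs
  by_cases hsT : s ∈ Ioo 0 T
  · rw [indicator_of_mem hsT, Measure.volume_eq_prod, integral_prod_symm _ hs,
      intervalIntegral.integral_of_le hsT.2.le, integral_Ioc_eq_integral_Ioo,
      ← integral_indicator measurableSet_Ioo]
    refine integral_congr_ae (.of_forall fun t => ?_)
    by_cases ht : t ∈ Ioo s T
    · simp only [indicator_of_mem ht]
      exact integral_congr_ae (.of_forall fun x =>
        indicator_of_mem (by exact ⟨hsT.1, ht.1, ht.2⟩) _)
    · have (x : EuclideanSpace ℝ (Fin N)) : duhamelIntegrand g ξ T ((x, t), s) = 0 :=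
        indicator_of_notMem (fun h => ht h.2) _
      simp [this, indicator_of_notMem ht]
  · have (p : EuclideanSpace ℝ (Fin N) × ℝ) : duhamelIntegrand g ξ T (p, s) = 0 :=
      indicator_of_notMem (fun h => hsT ⟨h.1, h.2.1.trans h.2.2⟩) _
    simp [this, indicator_of_notMem hsT]

end

/-- Lemma 4.3: F solves u_t - Δu = δ(x - ξ(t)) in the distribution sense:
for every φ ∈ C_c^∞(ℝ^N × (0,T)),
∫∫ (-φ_t - Δφ) F dx dt = ∫₀^T φ(ξ(t),t) dt. -/
theorem Fsol_distributional {N : ℕ} (hN : 2 ≤ N) (T : ℝ) (hT : 0 < T)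
    (ξ : ℝ → EuclideanSpace ℝ (Fin N)) (hξ : Continuous ξ)
    (φ : EuclideanSpace ℝ (Fin N) × ℝ → ℝ) (hφ : ContDiff ℝ (⊤ : ℕ∞) φ)
    (hφc : HasCompactSupport φ)
    (hφT : ∀ p : EuclideanSpace ℝ (Fin N) × ℝ, p.2 ∉ Ioo (0 : ℝ) T → φ p = 0) :
    ∫ p in (univ : Set (EuclideanSpace ℝ (Fin N))) ×ˢ Ioo (0 : ℝ) T,
        (-(deriv (fun τ => φ (p.1, τ)) p.2)
          - ∑ i, iteratedDeriv 2
              (fun h : ℝ => φ (p.1 + h • EuclideanSpace.single i (1 : ℝ), p.2)) 0)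
          * Fsol N ξ p.1 p.2
      = ∫ t in (0 : ℝ)..T, φ (ξ t, t) := by
  have hb := continuous_backwardHeat hφ
  obtain ⟨M, hM⟩ := exists_bound_backwardHeat hφ hφc
  have hop (p : EuclideanSpace ℝ (Fin N) × ℝ) : -(deriv (fun τ => φ (p.1, τ)) p.2)
      - ∑ i, iteratedDeriv 2
        (fun h : ℝ => φ (p.1 + h • EuclideanSpace.single i (1 : ℝ), p.2)) 0
      = -backwardHeat φ p := by
    rw [backwardHeat_eq hφ]
    ring
  simp only [hop]
  rw [setIntegral_mul_Fsol (g := fun p => -backwardHeat φ p),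
    integral_integral_duhamelIntegrand (g := fun p => -backwardHeat φ p) hb.neg.measurable
      (fun p => (norm_neg _).trans_le (hM p)) hξ.measurable hT.le]
  refine intervalIntegral.integral_congr fun s hs => ?_
  rw [uIcc_of_le hT.le] at hs
  exact integral_backwardHeat_mul_heatKernel hφ hφc hs.2
    (fun x => hφT (x, T) fun h => h.2.false) (ξ s)
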